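/- Let M = {(z,w) ∈ ℂ² : Im w = |z|²} with base point p = 0, and let M' = {(z₁,z₂,w) ∈ ℂ³ : Im w = |z₁|⁴ + |z₂|⁴}. Then for every ℓ ≥ 2 the mapping locus satisfies E_ℓ = {(z₁,z₂,w) ∈ M' : z₁ ≠ 0 and z₂ ≠ 0}. In particular, no finitely nondegenerate map of (M,0) into M' sends 0 to a point of M' with z₁ = 0 or z₂ = 0, while every point of M' with z₁ ≠ 0 and z₂ ≠ 0 is the image of 0 under some holomorphic map of (M,0) into M' which is finitely nondegenerate of order at most 2 at 0. -/

import Mathlib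

open Complex Topology

noncomputable section

/-- `ℂ^n`. -/
abbrev Cn (n : ℕ) : Type := EuclideanSpace ℂ (Fin n)

/-- `ℝ^m`. -/
abbrev Rm (m : ℕ) : Type := EuclideanSpace ℝ (Fin m)

/-- The vector of `ℂ^n` with entry `c` in the `j`-th coordinate and `0` elsewhere. -/
def cbasis {n : ℕ} (j : Fin n) (c : ℂ) : Cn n := EuclideanSpace.single j c

/-- The `j`-th component of the Wirtinger gradient `∂f(q)` of a real-valued function `f`. -/
def wirtD {n : ℕ} (f : Cn n → ℝ) (q : Cn n) : Fin n → ℂ := fun j =>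
  (1 / 2 : ℂ) * ((fderiv ℝ f q (cbasis j 1) : ℂ)
    - Complex.I * (fderiv ℝ f q (cbasis j Complex.I) : ℂ))

/-- The `j`-th component of `∂̄g(q)` for a complex-valued function `g`. -/
def wirtDBar {n : ℕ} (g : Cn n → ℂ) (q : Cn n) : Fin n → ℂ := fun j =>
  (1 / 2 : ℂ) * (fderiv ℝ g q (cbasis j 1) + Complex.I * fderiv ℝ g q (cbasis j Complex.I))

/-- The `j`-th component of `∂̄f(q)` for a real-valued function `f`. -/
def wirtDBarR {n : ℕ} (f : Cn n → ℝ) (q : Cn n) : Fin n → ℂ := fun j =>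
  (1 / 2 : ℂ) * ((fderiv ℝ f q (cbasis j 1) : ℂ)
    + Complex.I * (fderiv ℝ f q (cbasis j Complex.I) : ℂ))

/-- `M` is a generic real-analytic submanifold of codimension `d` near `p`. -/
def IsGenericAt {n : ℕ} (M : Set (Cn n)) (d : ℕ) (p : Cn n) : Prop :=
  p ∈ M ∧ ∃ (U : Set (Cn n)) (ρ : Cn n → Fin d → ℝ),
    IsOpen U ∧ p ∈ U ∧ (∀ k, AnalyticOnNhd ℝ (fun z => ρ z k) U) ∧
    (M ∩ U = {z | z ∈ U ∧ ∀ k, ρ z k = 0}) ∧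
    ∀ q ∈ M ∩ U, LinearIndependent ℂ (fun k : Fin d => wirtD (fun z => ρ z k) q)

/-- `S` is, near its point `q`, a real-analytic submanifold of (real) dimension `mdim`. -/
def IsRASubmanifoldAt {E : Type*} [NormedAddCommGroup E] [NormedSpace ℝ E]
    (S : Set E) (q : E) (mdim : ℕ) : Prop :=
  ∃ (c : ℕ) (U : Set E) (ρ : E → Fin c → ℝ),
    IsOpen U ∧ q ∈ U ∧ mdim + c = Module.finrank ℝ E ∧
    (∀ k, AnalyticOnNhd ℝ (fun z => ρ z k) U) ∧
    (S ∩ U = {z | z ∈ U ∧ ∀ k, ρ z k = 0}) ∧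
    ∀ x ∈ S ∩ U, LinearIndependent ℝ (fun k : Fin c => fderiv ℝ (fun z => ρ z k) x)

/-- The tangent space of a set at a point: the span of the tangent cone. -/
def tangentSpaceAt {E : Type*} [NormedAddCommGroup E] [NormedSpace ℝ E] (S : Set E) (q : E) :
    Submodule ℝ E := Submodule.span ℝ (tangentConeAt ℝ S q)

/-- Multiplication by `i` on `ℂ^n` as an `ℝ`-linear map. -/
def mulI {n : ℕ} : Cn n →ₗ[ℝ] Cn n :=
  (LinearMap.lsmul ℂ (Cn n) Complex.I).restrictScalars ℝ

/-- `M` (a generic submanifold of codimension `d`, hence of real dimension `2n - d`) is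
minimal at `p`: there is no real-analytic submanifold `S ⊆ M` through `p` of strictly
smaller dimension whose tangent spaces contain the complex tangent spaces of `M`. -/
def IsMinimalAt {n : ℕ} (M : Set (Cn n)) (d : ℕ) (p : Cn n) : Prop :=
  ¬ ∃ (S : Set (Cn n)) (mdim : ℕ), S ⊆ M ∧ p ∈ S ∧ mdim < 2 * n - d ∧
      (∀ q ∈ S, IsRASubmanifoldAt S q mdim) ∧
      ∀ q ∈ S, tangentSpaceAt M q ⊓ (tangentSpaceAt M q).map mulI ≤ tangentSpaceAt S q

/-- A real-analytic CR vector field of `M` near `p`. -/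
structure CRVectorField {N : ℕ} (M : Set (Cn N)) (p : Cn N) where
  coeff : Cn N → Fin N → ℂ
  dom : Set (Cn N)
  isOpen : IsOpen dom
  mem : p ∈ dom
  analytic : ∀ j, AnalyticOnNhd ℝ (fun z => coeff z j) dom
  tangent : ∀ (f : Cn N → ℝ) (U : Set (Cn N)), IsOpen U → p ∈ U → AnalyticOnNhd ℝ f U →
    (∀ z ∈ M ∩ U, f z = 0) →
    ∃ V, IsOpen V ∧ p ∈ V ∧ ∀ z ∈ M ∩ V, (∑ j, coeff z j * wirtDBarR f z j) = 0

/-- Application of a CR vector field to a complex-valued function. -/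
def CRVectorField.apply {N : ℕ} {M : Set (Cn N)} {p : Cn N} (L : CRVectorField M p)
    (g : Cn N → ℂ) : Cn N → ℂ := fun z => ∑ j, L.coeff z j * wirtDBar g z j

/-- Iterated application `L̄₁ ⋯ L̄ₖ g` of a list of CR vector fields. -/
def CRApplyList {N : ℕ} {M : Set (Cn N)} {p : Cn N} (Ls : List (CRVectorField M p))
    (g : Cn N → ℂ) : Cn N → ℂ := Ls.foldr CRVectorField.apply g

/-- `H` is finitely nondegenerate of order at most `ℓ` at `p` (as a map of `M` into `M'`). -/
def FinNondeg {N N' : ℕ} (M : Set (Cn N)) (p : Cn N) (M' : Set (Cn N')) (ℓ : ℕ)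
    (H : Cn N → Cn N') : Prop :=
  Submodule.span ℂ
    { v : Fin N' → ℂ | ∃ (Ls : List (CRVectorField M p)) (ρ' : Cn N' → ℝ) (U' : Set (Cn N')),
        Ls.length ≤ ℓ ∧ IsOpen U' ∧ H p ∈ U' ∧ AnalyticOnNhd ℝ ρ' U' ∧
        (∀ w ∈ M' ∩ U', ρ' w = 0) ∧
        v = fun j => CRApplyList Ls (fun z => wirtD ρ' (H z) j) p } = ⊤

/-- The mapping locus `E_ℓ ⊆ M'`. -/
def MappingLocus {N N' : ℕ} (M : Set (Cn N)) (p : Cn N) (M' : Set (Cn N')) (ℓ : ℕ) :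
    Set (Cn N') :=
  { p' | p' ∈ M' ∧ ∃ (Ω : Set (Cn N)) (H : Cn N → Cn N'),
      IsOpen Ω ∧ p ∈ Ω ∧ DifferentiableOn ℂ H Ω ∧ H p = p' ∧
      (∀ z ∈ M ∩ Ω, H z ∈ M') ∧ FinNondeg M p M' ℓ H }

/-- A semi-analytic subset of a real vector space. -/
def SemiAnalyticSet {E : Type*} [NormedAddCommGroup E] [NormedSpace ℝ E] (A : Set E) : Prop :=
  ∀ x : E, ∃ U : Set E, IsOpen U ∧ x ∈ U ∧
    ∃ (n k : ℕ) (f : Fin n → Fin k → E → ℝ) (iseq : Fin n → Fin k → Bool),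
      (∀ i j, AnalyticOnNhd ℝ (f i j) U) ∧
      A ∩ U = ⋃ i, ⋂ j, {x | x ∈ U ∧ if iseq i j then f i j x = 0 else 0 < f i j x}

/-- `A` is locally semi-analytic along `M'`. -/
def LocallySemiAnalyticOn {E : Type*} [NormedAddCommGroup E] [NormedSpace ℝ E]
    (M' A : Set E) : Prop :=
  ∀ q ∈ M', ∃ U : Set E, IsOpen U ∧ q ∈ U ∧ SemiAnalyticSet (A ∩ U)


/-- The sphere-like quadric `M = {Im w = |z|²} ⊆ ℂ²`. -/
def Mq : Set (Cn 2) := {v | (v 1).im = Complex.normSq (v 0)}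

/-- The hypersurface `M' = {Im w = |z₁|⁴ + |z₂|⁴} ⊆ ℂ³`. -/
def Mq' : Set (Cn 3) :=
  {u | (u 2).im = (Complex.normSq (u 0)) ^ 2 + (Complex.normSq (u 1)) ^ 2}

section Holo
variable {E : Type} [NormedAddCommGroup E] [NormedSpace ℂ E]

lemma holo_fderiv_bound {f : E → ℂ} {x0 : E} {r C : ℝ} (hr : 0 < r)
    (hd : ∀ y ∈ Metric.ball x0 (3*r), DifferentiableAt ℂ f y)
    (hC : ∀ y ∈ Metric.ball x0 (3*r), ‖f y‖ ≤ C) (y : E) (hy : y ∈ Metric.ball x0 (2*r)) :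
    ‖fderiv ℂ f y‖ ≤ C / (r/2) := by
  have hC0 : 0 ≤ C := le_trans (norm_nonneg _) (hC x0 (by simp [hr]))
  refine ContinuousLinearMap.opNorm_le_bound _ (by positivity) (fun v => ?_)
  by_cases hv : v = 0
  · simp [hv]
  have hv' : 0 < ‖v‖ := norm_pos_iff.mpr hv
  have hmem : ∀ t : ℂ, ‖t‖ ≤ r/2/‖v‖ → y + t • v ∈ Metric.ball x0 (3*r) := by
    intro t ht
    rw [mem_ball_iff_norm] at hy ⊢
    have h1 : ‖t • v‖ ≤ r/2 := by
      rw [norm_smul]; rwa [le_div_iff₀ hv'] at ht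
    calc ‖y + t • v - x0‖ = ‖(y - x0) + t • v‖ := by congr 1; abel
      _ ≤ ‖y - x0‖ + ‖t • v‖ := norm_add_le _ _
      _ < 3*r := by linarith
  have hda : ∀ t : ℂ, ‖t‖ ≤ r/2/‖v‖ → DifferentiableAt ℂ (fun t : ℂ => f (y + t • v)) t := by
    intro t ht
    have := hd _ (hmem t ht)
    exact DifferentiableAt.comp t (g := f) (f := fun t : ℂ => y + t • v) this (by fun_prop)
  have hR : 0 < r/2/‖v‖ := by positivity
  have key := Complex.norm_deriv_le_of_forall_mem_sphere_norm_le (c := (0:ℂ)) (R := r/2/‖v‖) (C := C)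
    (f := fun t : ℂ => f (y + t • v)) hR ?_ ?_
  · have hder : HasDerivAt (fun t : ℂ => f (y + t • v)) (fderiv ℂ f y v) 0 := by
      have h0 := (hd y (by simpa using hmem 0 (by simpa using hR.le))).hasFDerivAt
      have h1 : HasDerivAt (fun t : ℂ => y + t • v) v 0 := by
        simpa using ((hasDerivAt_id (0:ℂ)).smul_const v).const_add y
      have h0' : HasFDerivAt f (fderiv ℂ f y) (y + (0:ℂ) • v) := by simpa using h0
      exact h0'.comp_hasDerivAt (0:ℂ) h1
    rw [hder.deriv] at key
    calc _ ≤ _ := key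
      _ = _ := by field_simp
  · constructor
    · intro t ht
      exact (hda t (by simpa using (Metric.ball_subset_closedBall ht))).differentiableWithinAt
    · intro t ht
      refine (hda t ?_).continuousAt.continuousWithinAt
      simpa using Metric.closure_ball_subset_closedBall ht
  · intro t ht
    exact hC _ (hmem t (by simpa using (Metric.sphere_subset_closedBall ht)))

lemma holo_dir {f : E → ℂ} [FiniteDimensional ℂ E] {U : Set E} (hU : IsOpen U) (hf : DifferentiableOn ℂ f U) (v : E) :
    DifferentiableOn ℂ (fun x => fderiv ℂ f x v) U := by
  intro x0 hx0
  apply DifferentiableAt.differentiableWithinAt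
  have hda : ∀ y ∈ U, DifferentiableAt ℂ f y := fun y hy => hf.differentiableAt (hU.mem_nhds hy)
  have hb : ∀ᶠ y in 𝓝 x0, y ∈ U ∧ ‖f y‖ ≤ ‖f x0‖ + 1 := by
    refine Filter.Eventually.and (hU.mem_nhds hx0) ?_
    have := (hda x0 hx0).continuousAt.norm.eventually (gt_mem_nhds (show ‖f x0‖ < ‖f x0‖ + 1 by linarith))
    exact this.mono fun y hy => hy.le
  obtain ⟨ε, hε, hball⟩ := Metric.eventually_nhds_iff_ball.mp hb
  set r := ε/3 with hr
  set C := ‖f x0‖ + 1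
  have hr0 : 0 < r := by positivity
  have h3 : 3*r = ε := by rw [hr]; ring
  have hd : ∀ y ∈ Metric.ball x0 (3*r), DifferentiableAt ℂ f y := fun y hy => hda y (hball y (h3 ▸ hy)).1
  have hC : ∀ y ∈ Metric.ball x0 (3*r), ‖f y‖ ≤ C := fun y hy => (hball y (h3 ▸ hy)).2
  have hbd := holo_fderiv_bound hr0 hd hC
  have hC0 : 0 ≤ C := le_trans (norm_nonneg _) (hC x0 (by simp [hr0]))
  set R := r / (‖v‖ + 1) with hRdef
  have hR : 0 < R := by positivity
  have hmem : ∀ x ∈ Metric.ball x0 r, ∀ t : ℂ, ‖t‖ ≤ R → x + t • v ∈ Metric.ball x0 (2*r) := by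
    intro x hx t ht
    rw [mem_ball_iff_norm] at hx ⊢
    have h1 : ‖t • v‖ ≤ r := by
      rw [norm_smul]
      rw [hRdef, le_div_iff₀ (by positivity)] at ht
      nlinarith [norm_nonneg t, norm_nonneg v]
    calc ‖x + t • v - x0‖ = ‖(x - x0) + t • v‖ := by congr 1; abel
      _ ≤ ‖x - x0‖ + ‖t • v‖ := norm_add_le _ _
      _ < 2*r := by linarith
  have h23 : Metric.ball x0 (2*r) ⊆ Metric.ball x0 (3*r) := Metric.ball_subset_ball (by linarith)
  have hF : ∀ x ∈ Metric.ball x0 r, ∀ t : ℂ, ‖t‖ ≤ R → 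
      DifferentiableAt ℂ (fun t : ℂ => f (x + t • v)) t := by
    intro x hx t ht
    exact DifferentiableAt.comp t (g := f) (f := fun t : ℂ => x + t • v) 
      (hd _ (h23 (hmem x hx t ht))) (by fun_prop)
  -- Cauchy formula
  have hcauchy : ∀ x ∈ Metric.ball x0 r, fderiv ℂ f x v =
      (2 * Real.pi * I : ℂ)⁻¹ • ∮ ζ in C((0:ℂ), R), ((ζ - 0) ^ 2)⁻¹ • f (x + ζ • v) := by
    intro x hx
    have hder : HasDerivAt (fun t : ℂ => f (x + t • v)) (fderiv ℂ f x v) 0 := by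
      have h0 := (hd x (h23 (by simpa using hmem x hx 0 (by simpa using hR.le)))).hasFDerivAt
      have h1 : HasDerivAt (fun t : ℂ => x + t • v) v 0 := by
        simpa using ((hasDerivAt_id (0:ℂ)).smul_const v).const_add x
      have h0' : HasFDerivAt f (fderiv ℂ f x) (x + (0:ℂ) • v) := by simpa using h0
      exact h0'.comp_hasDerivAt (0:ℂ) h1
    rw [← hder.deriv]
    have hdc : DiffContOnCl ℂ (fun t : ℂ => f (x + t • v)) (Metric.ball 0 R) := by
      constructor
      · intro t ht
        exact (hF x hx t (by simpa using (Metric.ball_subset_closedBall ht))).differentiableWithinAt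
      · intro t ht
        refine (hF x hx t ?_).continuousAt.continuousWithinAt
        simpa using Metric.closure_ball_subset_closedBall ht
    have h1 := DiffContOnCl.circleIntegral_one_div_sub_center_pow_smul hR 1 hdc
    have h2 : (2 * Real.pi * I : ℂ) ≠ 0 := by simp [Real.pi_ne_zero]
    simp only [one_div] at h1
    norm_num at h1
    simp only [sub_zero]
    simp only [smul_eq_mul]
    rw [h1]
    field_simp
  have hdiff : DifferentiableAt ℂ (fun x => ∮ ζ in C((0:ℂ), R), ((ζ - 0) ^ 2)⁻¹ • f (x + ζ • v)) x0 := by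
    simp only [circleIntegral]
    have hcm : ∀ θ, ‖circleMap 0 R θ‖ ≤ R := by intro θ; simp [abs_of_pos hR]
    have hcm' : ∀ θ, ‖circleMap 0 R θ‖ = R := by intro θ; simp [abs_of_pos hR]
    have hcont : ∀ x ∈ Metric.ball x0 r, Continuous (fun θ : ℝ => 
        deriv (circleMap 0 R) θ • ((circleMap 0 R θ - 0) ^ 2)⁻¹ • f (x + circleMap 0 R θ • v)) := by
      intro x hx
      have h1 : Continuous fun θ : ℝ => f (x + circleMap 0 R θ • v) := by
        rw [continuous_iff_continuousAt]
        intro θ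
        have := (hF x hx _ (hcm θ)).continuousAt
        exact ContinuousAt.comp (f := circleMap 0 R) this (continuous_circleMap 0 R).continuousAt
      have h2 : Continuous fun θ : ℝ => ((circleMap 0 R θ - 0) ^ 2)⁻¹ := by
        apply Continuous.inv₀ (by fun_prop)
        intro θ
        simp [circleMap, hR.ne']
      have h3 : Continuous fun θ : ℝ => deriv (circleMap 0 R) θ := by
        simp only [deriv_circleMap]; fun_prop
      exact h3.smul (h2.smul h1)
    have hF' : ∀ θ : ℝ, ∀ x ∈ Metric.ball x0 r, HasFDerivAt (fun x => 
        deriv (circleMap 0 R) θ • ((circleMap 0 R θ - 0) ^ 2)⁻¹ • f (x + circleMap 0 R θ • v))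
        (deriv (circleMap 0 R) θ • ((circleMap 0 R θ - 0) ^ 2)⁻¹ • fderiv ℂ f (x + circleMap 0 R θ • v)) x := by
      intro θ x hx
      have h0 := (hd _ (h23 (hmem x hx _ (hcm θ)))).hasFDerivAt
      have h1 : HasFDerivAt (fun x => f (x + circleMap 0 R θ • v)) (fderiv ℂ f (x + circleMap 0 R θ • v)) x := by
        have := h0.comp x ((hasFDerivAt_id (𝕜 := ℂ) x).add_const (circleMap 0 R θ • v))
        simpa [Function.comp_def] using this
      exact (h1.const_smul ((circleMap 0 R θ - 0) ^ 2)⁻¹).const_smul (deriv (circleMap 0 R) θ)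
    let : MeasurableSpace E := borel E
    have : BorelSpace E := ⟨rfl⟩
    have : SecondCountableTopology E := by
      have : FiniteDimensional ℝ E := FiniteDimensional.complexToReal E
      have : ProperSpace E := FiniteDimensional.proper ℝ E
      infer_instance
    refine (intervalIntegral.hasFDerivAt_integral_of_dominated_of_fderiv_le (𝕜 := ℂ)
      (F := fun x θ => deriv (circleMap 0 R) θ • ((circleMap 0 R θ - 0) ^ 2)⁻¹ • f (x + circleMap 0 R θ • v))
      (F' := fun x θ => deriv (circleMap 0 R) θ • ((circleMap 0 R θ - 0) ^ 2)⁻¹ • fderiv ℂ f (x + circleMap 0 R θ • v))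
      (s := Metric.ball x0 r) (bound := fun _ => R * ((R^2)⁻¹ * (C / (r/2))))
      (Metric.ball_mem_nhds x0 hr0) ?_ ?_ ?_ ?_ ?_ ?_).differentiableAt
    · filter_upwards [Metric.ball_mem_nhds x0 hr0] with x hx
      exact (hcont x hx).aestronglyMeasurable
    · exact (hcont x0 (Metric.mem_ball_self hr0)).intervalIntegrable _ _
    · apply Measurable.aestronglyMeasurable
      have h1 : Measurable fun θ : ℝ => fderiv ℂ f (x0 + circleMap 0 R θ • v) :=
        (measurable_fderiv ℂ f).comp (by
          apply Continuous.measurable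
          have := continuous_circleMap 0 R
          fun_prop)
      have h2 : Measurable fun θ : ℝ => ((circleMap 0 R θ - 0) ^ 2)⁻¹ := by
        have := (continuous_circleMap 0 R).measurable
        fun_prop
      have h3 : Measurable fun θ : ℝ => deriv (circleMap 0 R) θ := measurable_deriv _
      exact h3.smul (h2.smul h1)
    · refine Filter.Eventually.of_forall fun θ _ x hx => ?_
      rw [norm_smul, norm_smul, deriv_circleMap]
      have := hbd _ (hmem x hx _ (hcm θ))
      simp only [sub_zero, norm_mul, norm_inv, norm_pow, hcm', Complex.norm_I, mul_one]
      gcongr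
    · simp
    · exact Filter.Eventually.of_forall fun θ _ x hx => hF' θ x hx
  have := hdiff.const_smul ((2 * Real.pi * I : ℂ)⁻¹)
  refine this.congr_of_eventuallyEq ?_
  filter_upwards [Metric.ball_mem_nhds x0 hr0] with x hx
  exact hcauchy x hx

lemma holo_contDiffOn_nat [FiniteDimensional ℂ E] {U : Set E} (hU : IsOpen U) (n : ℕ) :
    ∀ f : E → ℂ, DifferentiableOn ℂ f U → ContDiffOn ℂ n f U := by
  induction n with
  | zero => intro f hf; exact contDiffOn_zero.mpr hf.continuousOn
  | succ n ih =>
    intro f hf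
    have : ((n+1 : ℕ) : WithTop ℕ∞) = (n : WithTop ℕ∞) + 1 := by norm_cast
    rw [this, contDiffOn_succ_iff_fderiv_of_isOpen hU]
    refine ⟨hf, by simp, ?_⟩
    rw [contDiffOn_clm_apply]
    intro v
    exact ih _ (holo_dir hU hf v)

lemma holo_contDiffOn [FiniteDimensional ℂ E] {U : Set E} (hU : IsOpen U) {f : E → ℂ}
    (hf : DifferentiableOn ℂ f U) : ContDiffOn ℂ (⊤ : ℕ∞) f U :=
  contDiffOn_infty.mpr fun n => holo_contDiffOn_nat hU n f hf

end Holo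

lemma fderiv_tangent {E V : Type} [NormedAddCommGroup E] [NormedSpace ℝ E]
    [NormedAddCommGroup V] [NormedSpace ℝ V] {S : Set E} {F : E → V} {u v w : E} {φ : ℝ → ℝ} {d : ℝ}
    (hF : DifferentiableAt ℝ F u) (hS : ∀ᶠ y in 𝓝 u, y ∈ S → F y = 0)
    (hφ : HasDerivAt φ d 0) (hφ0 : φ 0 = 0) (hmem : ∀ t : ℝ, u + t • v + φ t • w ∈ S) :
    fderiv ℝ F u v + d • fderiv ℝ F u w = 0 := by
  have hγ : HasDerivAt (fun t : ℝ => u + t • v + φ t • w) (v + d • w) 0 := by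
    have h1 : HasDerivAt (fun t : ℝ => u + t • v) v 0 := by
      simpa using ((hasDerivAt_id (0:ℝ)).smul_const v).const_add u
    exact h1.add (hφ.smul_const w)
  have h0 : u + (0:ℝ) • v + φ 0 • w = u := by simp [hφ0]
  have hF' : HasFDerivAt F (fderiv ℝ F u) (u + (0:ℝ) • v + φ 0 • w) := by
    rw [h0]; exact hF.hasFDerivAt
  have hc := hF'.comp_hasDerivAt (0:ℝ) hγ
  have hz : (F ∘ fun t : ℝ => u + t • v + φ t • w) =ᶠ[𝓝 0] fun _ => 0 := by
    have ht : Filter.Tendsto (fun t : ℝ => u + t • v + φ t • w) (𝓝 0) (𝓝 u) := by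
      have := hγ.continuousAt.tendsto
      rwa [h0] at this
    filter_upwards [ht.eventually hS] with t h
    exact h (hmem t)
  have := (hc.congr_of_eventuallyEq hz.symm).unique (hasDerivAt_const (0:ℝ) (0:V))
  simpa using this

lemma Mq_tangent {V : Type} [NormedAddCommGroup V] [NormedSpace ℝ V] {F : Cn 2 → V} {z : Cn 2}
    (hz : z ∈ Mq) (hF : DifferentiableAt ℝ F z) (hS : ∀ᶠ y in 𝓝 z, y ∈ Mq → F y = 0) :
    fderiv ℝ F z (cbasis 0 1) = -(2 * (z 0).re) • fderiv ℝ F z (cbasis 1 I) ∧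
    fderiv ℝ F z (cbasis 0 I) = -(2 * (z 0).im) • fderiv ℝ F z (cbasis 1 I) ∧
    fderiv ℝ F z (cbasis 1 1) = 0 := by
  have hz' : (z 1).im = (z 0).re * (z 0).re + (z 0).im * (z 0).im := hz
  refine ⟨?_, ?_, ?_⟩
  · have := fderiv_tangent (u := z) (v := cbasis 0 1) (w := cbasis 1 I) 
      (φ := fun t => t * (2 * (z 0).re + t)) (d := 2 * (z 0).re) hF hS ?_ ?_ ?_
    · rw [neg_smul]; exact eq_neg_of_add_eq_zero_left this
    · have := (hasDerivAt_id (0:ℝ)).mul ((hasDerivAt_id (0:ℝ)).const_add (2 * (z 0).re))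
      simpa using! this
    · simp
    · intro t
      simp [Mq, cbasis, Complex.normSq_apply, hz']; ring
  · have := fderiv_tangent (u := z) (v := cbasis 0 I) (w := cbasis 1 I) 
      (φ := fun t => t * (2 * (z 0).im + t)) (d := 2 * (z 0).im) hF hS ?_ ?_ ?_
    · rw [neg_smul]; exact eq_neg_of_add_eq_zero_left this
    · have := (hasDerivAt_id (0:ℝ)).mul ((hasDerivAt_id (0:ℝ)).const_add (2 * (z 0).im))
      simpa using! this
    · simp
    · intro t
      simp [Mq, cbasis, Complex.normSq_apply, hz']; ring
  · have := fderiv_tangent (u := z) (v := cbasis 1 1) (w := cbasis 1 I) 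
      (φ := fun t => 0) (d := 0) hF hS (hasDerivAt_const _ _) rfl ?_
    · simpa using this
    · intro t
      simp [Mq, cbasis, Complex.normSq_apply, hz']

lemma Mq'_tangent {F : Cn 3 → ℝ} {u : Cn 3} (hu : u ∈ Mq') (hF : DifferentiableAt ℝ F u)
    (hS : ∀ᶠ y in 𝓝 u, y ∈ Mq' → F y = 0) (j : Fin 3) (hj : j ≠ 2) :
    wirtD F u j = u j * (-2 * (starRingEnd ℂ (u j)) ^ 2 * (fderiv ℝ F u (cbasis 2 I) : ℂ)) := by
  have hu' : (u 2).im = ((u 0).re * (u 0).re + (u 0).im * (u 0).im)^2 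
    + ((u 1).re * (u 1).re + (u 1).im * (u 1).im)^2 := hu
  have key : ∀ c : ℂ, fderiv ℝ F u (cbasis j c) + (4 * normSq (u j) * ((u j).re * c.re + (u j).im * c.im)) * fderiv ℝ F u (cbasis 2 I) = 0 := by
    intro c
    have := fderiv_tangent (u := u) (v := cbasis j c) (w := cbasis 2 I) 
      (φ := fun t => t * ((2 * ((u j).re * c.re + (u j).im * c.im) + t * normSq c) * 
        (2 * normSq (u j) + t * (2 * ((u j).re * c.re + (u j).im * c.im) + t * normSq c))))
      (d := 4 * normSq (u j) * ((u j).re * c.re + (u j).im * c.im)) hF hS ?_ ?_ ?_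
    · simpa using this
    · have hq : HasDerivAt (fun t : ℝ => (2 * ((u j).re * c.re + (u j).im * c.im) + t * normSq c) * 
        (2 * normSq (u j) + t * (2 * ((u j).re * c.re + (u j).im * c.im) + t * normSq c))) _ 0 :=
        (DifferentiableAt.hasDerivAt (by fun_prop))
      have := (hasDerivAt_id (0:ℝ)).mul hq
      convert! this using 1
      simp; ring
    · simp
    · intro t
      have : j = 0 ∨ j = 1 := by omega
      rcases this with rfl | rfl
      · simp [Mq', cbasis, Complex.normSq_apply, hu']; ring
      · simp [Mq', cbasis, Complex.normSq_apply, hu']; ring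
  have h1 := key 1
  have hI := key I
  simp only [one_re, one_im, I_re, I_im, mul_one, mul_zero, add_zero, zero_add] at h1 hI
  unfold wirtD
  rw [eq_neg_of_add_eq_zero_left h1, eq_neg_of_add_eq_zero_left hI]
  apply Complex.ext <;> simp [Complex.normSq_apply, pow_two] <;> ring

def Sm {n : ℕ} (g : Cn n → ℂ) : Prop := ∀ᶠ z in 𝓝 (0 : Cn n), ContDiffAt ℝ (⊤ : ℕ∞) g z

lemma contDiffAt_fderiv_apply {E V : Type} [NormedAddCommGroup E] [NormedSpace ℝ E]
    [NormedAddCommGroup V] [NormedSpace ℝ V] {F : E → V} {x : E} 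
    (h : ContDiffAt ℝ (⊤ : ℕ∞) F x) (v : E) : ContDiffAt ℝ (⊤ : ℕ∞) (fun y => fderiv ℝ F y v) x :=
  (h.fderiv_right (m := (⊤ : ℕ∞)) (by simp)).clm_apply contDiffAt_const

lemma Sm_apply {M : Set (Cn 2)} (L : CRVectorField M 0) {g : Cn 2 → ℂ} (hg : Sm g) : Sm (L.apply g) := by
  filter_upwards [hg, L.isOpen.mem_nhds L.mem] with z hz hd
  unfold CRVectorField.apply wirtDBar
  refine ContDiffAt.sum fun j _ => ?_
  refine ContDiffAt.mul (L.analytic j z hd).contDiffAt ?_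
  exact contDiffAt_const.mul ((contDiffAt_fderiv_apply hz _).add (contDiffAt_const.mul (contDiffAt_fderiv_apply hz _)))

def rho0 (z : Cn 2) : ℝ := (z 1).im - normSq (z 0)

lemma rho0_contDiff (n : WithTop ℕ∞) : ContDiff ℝ n rho0 := by
  have h1 : ∀ j : Fin 2, ContDiff ℝ n (fun z : Cn 2 => (z j).im) := fun j =>
    (Complex.imCLM.comp ((EuclideanSpace.proj j : Cn 2 →L[ℂ] ℂ).restrictScalars ℝ)).contDiff
  have h2 : ∀ j : Fin 2, ContDiff ℝ n (fun z : Cn 2 => (z j).re) := fun j =>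
    (Complex.reCLM.comp ((EuclideanSpace.proj j : Cn 2 →L[ℂ] ℂ).restrictScalars ℝ)).contDiff
  have : rho0 = fun z : Cn 2 => (z 1).im - ((z 0).re * (z 0).re + (z 0).im * (z 0).im) := by
    ext z; simp [rho0, normSq_apply]
  rw [this]
  exact (h1 1).sub (((h2 0).mul (h2 0)).add ((h1 0).mul (h1 0)))

lemma rho0_fderiv (z : Cn 2) : fderiv ℝ rho0 z (cbasis 1 I) = 1 := by
  have h0 : HasFDerivAt rho0 (fderiv ℝ rho0 z) (z + (0:ℝ) • cbasis 1 I) := by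
    simpa using ((rho0_contDiff 1).differentiable (by simp) z).hasFDerivAt
  have h1 : HasDerivAt (fun t : ℝ => z + t • (cbasis 1 I : Cn 2)) (cbasis 1 I) 0 := by
    simpa using ((hasDerivAt_id (0:ℝ)).smul_const (cbasis 1 I : Cn 2)).const_add z
  have h2 := h0.comp_hasDerivAt (0:ℝ) h1
  refine h2.unique ?_
  have : (rho0 ∘ fun t : ℝ => z + t • (cbasis 1 I : Cn 2)) = fun t : ℝ => t + rho0 z := by
    ext t
    simp [rho0, cbasis]; ring
  rw [this]
  exact (hasDerivAt_id (0:ℝ)).add_const _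

lemma coeff_rel (L : CRVectorField Mq 0) : 
    ∀ᶠ z in 𝓝 (0 : Cn 2), z ∈ Mq → L.coeff z 0 * (-(z 0)) + L.coeff z 1 * (I/2) = 0 := by
  have hv : ∀ z ∈ Mq, rho0 z = 0 := by
    intro z hz
    have : (z 1).im = normSq (z 0) := hz
    simp [rho0, this]
  obtain ⟨V, hV, h0, h⟩ := L.tangent rho0 Set.univ isOpen_univ trivial 
    (by rw [← contDiff_omega_iff_analyticOnNhd]; exact rho0_contDiff _) (fun z hz => hv z hz.1)
  filter_upwards [hV.mem_nhds h0] with z hz hM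
  have := h z ⟨hM, hz⟩
  obtain ⟨a, b, c⟩ := Mq_tangent hM ((rho0_contDiff 1).differentiable (by simp) z) (Filter.Eventually.of_forall hv)
  rw [Fin.sum_univ_two] at this
  unfold wirtDBarR at this
  rw [a, b, c, rho0_fderiv] at this
  have e : -(z 0) = (1/2:ℂ) * (((-(2 * (z 0).re) • (1:ℝ) : ℝ) : ℂ) + I * ((-(2 * (z 0).im) • (1:ℝ) : ℝ) : ℂ)) := by
    apply Complex.ext <;> simp
  rw [e]
  convert this using 3
  simp; ring

lemma apply_vanish (L : CRVectorField Mq 0) {g : Cn 2 → ℂ} (hg : Sm g) 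
    (hv : ∀ᶠ z in 𝓝 (0 : Cn 2), z ∈ Mq → g z = 0) :
    ∀ᶠ z in 𝓝 (0 : Cn 2), z ∈ Mq → L.apply g z = 0 := by
  filter_upwards [hg, eventually_eventually_nhds.mpr hv, coeff_rel L] with z h1 h2 h3 hM
  obtain ⟨a, b, c⟩ := Mq_tangent hM (h1.differentiableAt (by simp)) h2
  unfold CRVectorField.apply wirtDBar
  rw [Fin.sum_univ_two, a, b, c]
  have h3 := h3 hM
  have e : z 0 = ((z 0).re : ℂ) + (z 0).im * I := (re_add_im _).symm
  rw [e] at h3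
  simp only [real_smul]
  push_cast
  linear_combination (fderiv ℝ g z (cbasis 1 I)) * h3

lemma wirtDBar_holo_mul {n : ℕ} {f k : Cn n → ℂ} {z : Cn n} (hf : DifferentiableAt ℂ f z) 
    (hk : DifferentiableAt ℝ k z) (j : Fin n) :
    wirtDBar (fun z => f z * k z) z j = f z * wirtDBar k z j := by
  have hf' := hf.restrictScalars ℝ
  have hI : fderiv ℝ f z (cbasis j I) = I * fderiv ℝ f z (cbasis j 1) := by
    rw [hf.fderiv_restrictScalars ℝ]
    simp only [ContinuousLinearMap.coe_restrictScalars']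
    rw [← smul_eq_mul, ← map_smul]
    congr 1
    ext i; simp [cbasis]
  unfold wirtDBar
  rw [fderiv_fun_mul hf' hk]
  simp only [add_apply, smul_apply, smul_eq_mul]
  rw [hI]
  linear_combination (1/2 * k z * fderiv ℝ f z (cbasis j 1)) * Complex.I_mul_I

lemma apply_holo_mul {M : Set (Cn 2)} (L : CRVectorField M 0) {f k : Cn 2 → ℂ} {z : Cn 2} (hf : DifferentiableAt ℂ f z) 
    (hk : DifferentiableAt ℝ k z) :
    L.apply (fun z => f z * k z) z = f z * L.apply k z := by
  unfold CRVectorField.apply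
  simp_rw [wirtDBar_holo_mul hf hk, Finset.mul_sum]
  exact Finset.sum_congr rfl fun j _ => by ring

lemma apply_sub {M : Set (Cn 2)} (L : CRVectorField M 0) {f k : Cn 2 → ℂ} {z : Cn 2} (hf : DifferentiableAt ℝ f z) 
    (hk : DifferentiableAt ℝ k z) :
    L.apply (fun z => f z - k z) z = L.apply f z - L.apply k z := by
  unfold CRVectorField.apply wirtDBar
  rw [fderiv_fun_sub hf hk, ← Finset.sum_sub_distrib]
  exact Finset.sum_congr rfl fun j _ => by simp; ring

lemma list_factor {f : Cn 2 → ℂ} (hf : ∀ᶠ z in 𝓝 (0 : Cn 2), DifferentiableAt ℂ f z) (hfS : Sm f)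
    {g k : Cn 2 → ℂ} (hg : Sm g) (hk : Sm k) 
    (h : ∀ᶠ z in 𝓝 (0 : Cn 2), z ∈ Mq → g z = f z * k z) (Ls : List (CRVectorField Mq 0)) :
    Sm (CRApplyList Ls g) ∧ ∃ k', Sm k' ∧ 
      ∀ᶠ z in 𝓝 (0 : Cn 2), z ∈ Mq → CRApplyList Ls g z = f z * k' z := by
  induction Ls with
  | nil => exact ⟨hg, k, hk, h⟩
  | cons L Ls ih =>
    obtain ⟨hS, k', hk', hfac⟩ := ih
    have e : CRApplyList (L :: Ls) g = L.apply (CRApplyList Ls g) := rfl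
    rw [e]
    refine ⟨Sm_apply L hS, L.apply k', Sm_apply L hk', ?_⟩
    have hv := apply_vanish L (g := fun z => CRApplyList Ls g z - f z * k' z) ?_ ?_
    · filter_upwards [hv, hf, hfS, hS, hk'] with z h1 h2 h3 h4 h5 hM
      have := h1 hM
      rw [apply_sub L (h4.differentiableAt (by simp)) ((h3.mul h5).differentiableAt (by simp)),
        apply_holo_mul L h2 (h5.differentiableAt (by simp))] at this
      exact sub_eq_zero.mp this
    · filter_upwards [hfS, hS, hk'] with z h3 h4 h5
      exact h4.sub (h3.mul h5)
    · filter_upwards [hfac] with z h1 hM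
      rw [h1 hM, sub_self]

lemma zero_mem_Mq : (0 : Cn 2) ∈ Mq := by simp [Mq]

lemma degenerate {Ω : Set (Cn 2)} {H : Cn 2 → Cn 3} (hΩ : IsOpen Ω) (h0 : (0 : Cn 2) ∈ Ω)
    (hH : DifferentiableOn ℂ H Ω) (hM : ∀ z ∈ Mq ∩ Ω, H z ∈ Mq') {ℓ : ℕ}
    (hnd : FinNondeg Mq 0 Mq' ℓ H) (j : Fin 3) (hj : j ≠ 2) : H 0 j ≠ 0 := by
  intro hz
  have hcd : ∀ i : Fin 3, DifferentiableOn ℂ (fun z => H z i) Ω := fun i =>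
    (EuclideanSpace.proj i : Cn 3 →L[ℂ] ℂ).differentiable.comp_differentiableOn hH
  have hcs : ∀ z ∈ Ω, ∀ i : Fin 3, ContDiffAt ℝ (⊤ : ℕ∞) (fun z => H z i) z := fun z hz i =>
    ((holo_contDiffOn hΩ (hcd i)).contDiffAt (hΩ.mem_nhds hz)).restrict_scalars ℝ
  have hHs : ∀ z ∈ Ω, ContDiffAt ℝ (⊤ : ℕ∞) H z := fun z hz =>
    (contDiffAt_euclidean (𝕜 := ℂ).mpr fun i =>
      (holo_contDiffOn hΩ (hcd i)).contDiffAt (hΩ.mem_nhds hz)).restrict_scalars ℝ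
  have hΩn := hΩ.mem_nhds h0
  have hcont : ContinuousAt H 0 := (hHs 0 h0).continuousAt
  have hle : Submodule.span ℂ
    { v : Fin 3 → ℂ | ∃ (Ls : List (CRVectorField Mq 0)) (ρ' : Cn 3 → ℝ) (U' : Set (Cn 3)),
        Ls.length ≤ ℓ ∧ IsOpen U' ∧ H 0 ∈ U' ∧ AnalyticOnNhd ℝ ρ' U' ∧
        (∀ w ∈ Mq' ∩ U', ρ' w = 0) ∧
        v = fun j => CRApplyList Ls (fun z => wirtD ρ' (H z) j) 0 } ≤ LinearMap.ker (LinearMap.proj j : (Fin 3 → ℂ) →ₗ[ℂ] ℂ) := by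
    rw [Submodule.span_le]
    rintro v ⟨Ls, ρ', U', -, hU', hpU, han, hvan, rfl⟩
    simp only [SetLike.mem_coe, LinearMap.mem_ker, LinearMap.proj_apply]
    have hU'' : ∀ᶠ z in 𝓝 (0 : Cn 2), H z ∈ U' := hcont.eventually (hU'.mem_nhds hpU)
    have hfd : ∀ v, ∀ᶠ z in 𝓝 (0 : Cn 2), ContDiffAt ℝ (⊤ : ℕ∞) (fun z => ((fderiv ℝ ρ' (H z) v : ℝ) : ℂ)) z := by
      intro v
      filter_upwards [hU'', hΩn] with z h1 h2
      have h3 : ContDiffAt ℝ (⊤ : ℕ∞) (fun y => fderiv ℝ ρ' y v) (H z) :=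
        contDiffAt_fderiv_apply (han _ h1).contDiffAt v
      have h4 := ContDiffAt.comp z h3 (hHs z h2)
      exact Complex.ofRealCLM.contDiff.contDiffAt.comp z h4
    have hlf := list_factor (f := fun z => H z j) (g := fun z => wirtD ρ' (H z) j)
      (k := fun z => -2 * (starRingEnd ℂ (H z j)) ^ 2 * (fderiv ℝ ρ' (H z) (cbasis 2 I) : ℂ)) ?_ ?_ ?_ ?_ ?_ Ls
    · obtain ⟨-, k', -, hfac⟩ := hlf
      have := hfac.self_of_nhds zero_mem_Mq
      rw [this, hz, zero_mul]
    · filter_upwards [hΩn] with z h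
      exact (hcd j).differentiableAt (hΩ.mem_nhds h)
    · filter_upwards [hΩn] with z h
      exact hcs z h j
    · filter_upwards [hfd (cbasis j 1), hfd (cbasis j I)] with z h1 h2
      unfold wirtD
      exact contDiffAt_const.mul (h1.sub (contDiffAt_const.mul h2))
    · filter_upwards [hΩn, hfd (cbasis 2 I)] with z h1 h2
      have h3 : ContDiffAt ℝ (⊤ : ℕ∞) (fun z => starRingEnd ℂ (H z j)) z :=
        Complex.conjCLE.contDiff.contDiffAt.comp z (hcs z h1 j)
      exact (contDiffAt_const.mul (h3.pow 2)).mul h2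
    · filter_upwards [hΩn, hU''] with z h1 h2 h3
      refine Mq'_tangent (hM z ⟨h3, h1⟩) (han _ h2).differentiableAt ?_ j hj
      filter_upwards [hU'.mem_nhds h2] with y hy hy'
      exact hvan y ⟨hy', hy⟩
  rw [FinNondeg] at hnd
  rw [hnd] at hle
  have : (Pi.single j 1 : Fin 3 → ℂ) ∈ LinearMap.ker (LinearMap.proj j : (Fin 3 → ℂ) →ₗ[ℂ] ℂ) := hle trivial
  simp at this

lemma fderiv_dir {𝕜 E V : Type} [NontriviallyNormedField 𝕜] [NormedAddCommGroup E] [NormedSpace 𝕜 E]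
    [NormedAddCommGroup V] [NormedSpace 𝕜 V] {F : E → V} {z v : E} {d : V}
    (hF : DifferentiableAt 𝕜 F z) (h : HasDerivAt (fun t : 𝕜 => F (z + t • v)) d 0) :
    fderiv 𝕜 F z v = d := by
  have h0 : HasFDerivAt F (fderiv 𝕜 F z) (z + (0:𝕜) • v) := by
    simpa using hF.hasFDerivAt
  have h1 : HasDerivAt (fun t : 𝕜 => z + t • v) v 0 := by
    simpa using ((hasDerivAt_id (0:𝕜)).smul_const v).const_add z
  exact (h0.comp_hasDerivAt (0:𝕜) h1).unique h

def L0 : CRVectorField Mq 0 where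
  coeff z := ![1, -2 * I * z 0]
  dom := Set.univ
  isOpen := isOpen_univ
  mem := trivial
  analytic := by
    intro j
    rw [← contDiff_omega_iff_analyticOnNhd]
    have h : ContDiff ℝ ⊤ (fun z : Cn 2 => z 0) :=
      ((EuclideanSpace.proj 0 : Cn 2 →L[ℂ] ℂ).restrictScalars ℝ).contDiff
    fin_cases j
    · simpa using contDiff_const
    · exact (contDiff_const (c := -2 * I)).mul h
  tangent := by
    intro f U hU h0 hf hv
    refine ⟨U, hU, h0, fun z hz => ?_⟩
    obtain ⟨a, b, c⟩ := Mq_tangent hz.1 (hf z hz.2).differentiableAt (by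
      filter_upwards [hU.mem_nhds hz.2] with y hy hy'
      exact hv y ⟨hy', hy⟩)
    unfold wirtDBarR
    rw [Fin.sum_univ_two, a, b, c]
    apply Complex.ext <;> simp <;> ring

lemma apply_congr {M : Set (Cn 2)} (L : CRVectorField M 0) {g g' : Cn 2 → ℂ} {z : Cn 2}
    (h : g =ᶠ[𝓝 z] g') : L.apply g z = L.apply g' z := by
  unfold CRVectorField.apply wirtDBar
  rw [h.fderiv_eq]

lemma apply_add {M : Set (Cn 2)} (L : CRVectorField M 0) {f k : Cn 2 → ℂ} {z : Cn 2}
    (hf : DifferentiableAt ℝ f z) (hk : DifferentiableAt ℝ k z) :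
    L.apply (fun z => f z + k z) z = L.apply f z + L.apply k z := by
  unfold CRVectorField.apply wirtDBar
  rw [fderiv_fun_add hf hk, ← Finset.sum_add_distrib]
  exact Finset.sum_congr rfl fun j _ => by simp; ring

lemma diff_conj {K : Cn 2 → ℂ} {z : Cn 2} (hK : DifferentiableAt ℂ K z) :
    DifferentiableAt ℝ (fun z => starRingEnd ℂ (K z)) z :=
  Complex.conjCLE.differentiable.differentiableAt.comp z (hK.restrictScalars ℝ)

lemma wirtDBar_conj {K : Cn 2 → ℂ} {z : Cn 2} (hK : DifferentiableAt ℂ K z) (j : Fin 2) :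
    wirtDBar (fun z => starRingEnd ℂ (K z)) z j = starRingEnd ℂ (fderiv ℂ K z (cbasis j 1)) := by
  have h1 : HasFDerivAt (fun z => starRingEnd ℂ (K z))
      ((Complex.conjCLE : ℂ →L[ℝ] ℂ).comp ((fderiv ℂ K z).restrictScalars ℝ)) z :=
    Complex.conjCLE.hasFDerivAt.comp z (hK.hasFDerivAt.restrictScalars ℝ)
  have hI : fderiv ℂ K z (cbasis j I) = I * fderiv ℂ K z (cbasis j 1) := by
    rw [← smul_eq_mul, ← map_smul]
    congr 1
    ext i; simp [cbasis]
  unfold wirtDBar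
  rw [h1.fderiv]
  simp [hI]
  linear_combination (-1/2 * starRingEnd ℂ (fderiv ℂ K z (cbasis j 1))) * Complex.I_mul_I

lemma L0_conj {K : Cn 2 → ℂ} {z : Cn 2} (hK : DifferentiableAt ℂ K z) :
    L0.apply (fun z => starRingEnd ℂ (K z)) z = starRingEnd ℂ (fderiv ℂ K z (cbasis 0 1))
      + (-2 * I * z 0) * starRingEnd ℂ (fderiv ℂ K z (cbasis 1 1)) := by
  unfold CRVectorField.apply
  rw [Fin.sum_univ_two, wirtDBar_conj hK, wirtDBar_conj hK]
  simp [L0]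

lemma L0_one {m K : Cn 2 → ℂ} {z : Cn 2} (hm : DifferentiableAt ℂ m z) (hK : DifferentiableAt ℂ K z) :
    L0.apply (fun z => m z * starRingEnd ℂ (K z)) z = m z * (starRingEnd ℂ (fderiv ℂ K z (cbasis 0 1))
      + (-2 * I * z 0) * starRingEnd ℂ (fderiv ℂ K z (cbasis 1 1))) := by
  rw [apply_holo_mul L0 hm (diff_conj hK), L0_conj hK]

lemma L0_two {m K : Cn 2 → ℂ} (hm : ∀ᶠ z in 𝓝 (0 : Cn 2), DifferentiableAt ℂ m z)
    (hK : ∀ᶠ z in 𝓝 (0 : Cn 2), DifferentiableAt ℂ K z) :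
    L0.apply (L0.apply (fun z => m z * starRingEnd ℂ (K z))) 0 =
      m 0 * starRingEnd ℂ (fderiv ℂ (fun z => fderiv ℂ K z (cbasis 0 1)) 0 (cbasis 0 1)) := by
  have hdir : ∀ v, DifferentiableAt ℂ (fun z => fderiv ℂ K z v) 0 := by
    intro v
    obtain ⟨U, hU, hUo, h0⟩ := eventually_nhds_iff.mp hK
    exact (holo_dir hUo (fun z hz => (hU z hz).differentiableWithinAt) v).differentiableAt
      (hUo.mem_nhds h0)
  have hz0 : DifferentiableAt ℂ (fun z : Cn 2 => -2 * I * z 0) 0 :=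
    (EuclideanSpace.proj 0 : Cn 2 →L[ℂ] ℂ).differentiableAt.const_mul _
  rw [apply_congr L0 (g' := fun z => m z * (starRingEnd ℂ (fderiv ℂ K z (cbasis 0 1))
      + (-2 * I * z 0) * starRingEnd ℂ (fderiv ℂ K z (cbasis 1 1)))) ?_]
  · have h2 : DifferentiableAt ℝ (fun z : Cn 2 => (-2 * I * z 0) * starRingEnd ℂ (fderiv ℂ K z (cbasis 1 1))) 0 :=
      (hz0.restrictScalars ℝ).mul (diff_conj (hdir _))
    rw [apply_holo_mul L0 hm.self_of_nhds ((diff_conj (hdir _)).fun_add h2),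
      apply_add L0 (diff_conj (hdir _)) h2, L0_conj (hdir _), apply_holo_mul L0 hz0 (diff_conj (hdir _))]
    simp
  · filter_upwards [hm, hK] with z h1 h2
    exact L0_one h1 h2

lemma L0_const (c : ℂ) : L0.apply (fun _ => c) = fun _ => 0 := by
  ext z
  simp [CRVectorField.apply, wirtDBar]

def rho1 (u : Cn 3) : ℝ := (u 2).im - (normSq (u 0)) ^ 2 - (normSq (u 1)) ^ 2

lemma rho1_contDiff (n : WithTop ℕ∞) : ContDiff ℝ n rho1 := by
  have h1 : ∀ j : Fin 3, ContDiff ℝ n (fun z : Cn 3 => (z j).im) := fun j =>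
    (Complex.imCLM.comp ((EuclideanSpace.proj j : Cn 3 →L[ℂ] ℂ).restrictScalars ℝ)).contDiff
  have h2 : ∀ j : Fin 3, ContDiff ℝ n (fun z : Cn 3 => (z j).re) := fun j =>
    (Complex.reCLM.comp ((EuclideanSpace.proj j : Cn 3 →L[ℂ] ℂ).restrictScalars ℝ)).contDiff
  have : rho1 = fun z : Cn 3 => (z 2).im - ((z 0).re * (z 0).re + (z 0).im * (z 0).im)^2
     - ((z 1).re * (z 1).re + (z 1).im * (z 1).im)^2 := by
    ext z; simp [rho1, normSq_apply]
  rw [this]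
  exact ((h1 2).sub ((((h2 0).mul (h2 0)).add ((h1 0).mul (h1 0))).pow 2)).sub
    ((((h2 1).mul (h2 1)).add ((h1 1).mul (h1 1))).pow 2)

lemma rho1_fderiv (u : Cn 3) (c : ℂ) :
    fderiv ℝ rho1 u (cbasis 0 c) = -(4 * normSq (u 0) * ((u 0).re * c.re + (u 0).im * c.im)) ∧
    fderiv ℝ rho1 u (cbasis 1 c) = -(4 * normSq (u 1) * ((u 1).re * c.re + (u 1).im * c.im)) ∧
    fderiv ℝ rho1 u (cbasis 2 c) = c.im := by
  have hd := (rho1_contDiff 1).differentiable (by simp) u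
  have aux : ∀ (j : Fin 3), HasDerivAt (fun t : ℝ => rho1 u - t * ((2 * ((u j).re * c.re + (u j).im * c.im) + t * normSq c) * 
        (2 * normSq (u j) + t * (2 * ((u j).re * c.re + (u j).im * c.im) + t * normSq c))))
        (-(4 * normSq (u j) * ((u j).re * c.re + (u j).im * c.im))) 0 := by
    intro j
    have hq : HasDerivAt (fun t : ℝ => (2 * ((u j).re * c.re + (u j).im * c.im) + t * normSq c) * 
        (2 * normSq (u j) + t * (2 * ((u j).re * c.re + (u j).im * c.im) + t * normSq c))) _ 0 :=
        (DifferentiableAt.hasDerivAt (by fun_prop))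
    have := ((hasDerivAt_id (0:ℝ)).mul hq).const_sub (rho1 u)
    convert! this using 1
    simp; ring
  refine ⟨fderiv_dir hd ?_, fderiv_dir hd ?_, fderiv_dir hd ?_⟩
  · refine (aux 0).congr_of_eventuallyEq (Filter.Eventually.of_forall fun t => ?_)
    simp [rho1, cbasis, Complex.normSq_apply]; ring
  · refine (aux 1).congr_of_eventuallyEq (Filter.Eventually.of_forall fun t => ?_)
    simp [rho1, cbasis, Complex.normSq_apply]; ring
  · have : HasDerivAt (fun t : ℝ => rho1 u + t * c.im) c.im 0 := by
      simpa using ((hasDerivAt_id (0:ℝ)).mul_const c.im).const_add (rho1 u)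
    refine this.congr_of_eventuallyEq (Filter.Eventually.of_forall fun t => ?_)
    simp [rho1, cbasis, Complex.normSq_apply]; ring

lemma rho1_wirtD (u : Cn 3) : wirtD rho1 u 0 = -2 * u 0 * starRingEnd ℂ ((u 0)^2) ∧
    wirtD rho1 u 1 = -2 * u 1 * starRingEnd ℂ ((u 1)^2) ∧ wirtD rho1 u 2 = -I/2 := by
  unfold wirtD
  refine ⟨?_, ?_, ?_⟩
  · rw [(rho1_fderiv u 1).1, (rho1_fderiv u I).1]
    apply Complex.ext <;> simp [normSq_apply, pow_two] <;> ring
  · rw [(rho1_fderiv u 1).2.1, (rho1_fderiv u I).2.1]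
    apply Complex.ext <;> simp [normSq_apply, pow_two] <;> ring
  · rw [(rho1_fderiv u 1).2.2, (rho1_fderiv u I).2.2]
    simp; ring

def Ff (z : Cn 2) : ℂ := 2 * z 0 * (2 + I * z 1) / (4 - z 1 ^ 2)
def Gf (z : Cn 2) : ℂ := 4 * z 0 ^ 2 / (4 - z 1 ^ 2)
def hf (z : Cn 2) : ℂ := 4 * z 1 / (4 - z 1 ^ 2)

lemma sphere_map {z : Cn 2} (hz : z ∈ Mq) (hd : 4 - z 1 ^ 2 ≠ 0) :
    (hf z).im = normSq (Ff z) + normSq (Gf z) := by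
  have hz' : (z 1).im = (z 0).re * (z 0).re + (z 0).im * (z 0).im := hz
  have hn : normSq (4 - z 1 ^ 2) ≠ 0 := by simpa using hd
  have h1 : (hf z).im = (4 * z 1 * starRingEnd ℂ (4 - z 1 ^2)).im / normSq (4 - z 1 ^ 2) := by
    have e : hf z = (4 * z 1 * starRingEnd ℂ (4 - z 1 ^2)) / ((normSq (4 - z 1 ^ 2) : ℝ) : ℂ) := by
      have hc : starRingEnd ℂ (4 - z 1 ^2) ≠ 0 := by rwa [Ne, map_eq_zero]
      rw [← Complex.mul_conj, hf, mul_div_mul_right _ _ hc]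
    rw [e, Complex.div_ofReal_im]
  rw [h1, Ff, Gf, normSq_div, normSq_div, ← add_div]
  congr 1
  simp [normSq_apply, pow_two]
  rw [hz']
  ring

lemma den_ne : ∀ᶠ z in 𝓝 (0 : Cn 2), 4 - z 1 ^ 2 ≠ 0 := by
  have : ContinuousAt (fun z : Cn 2 => 4 - z 1 ^ 2) 0 := by fun_prop
  exact this.eventually_ne (by simp)

lemma diff_coord (j : Fin 2) (z : Cn 2) : DifferentiableAt ℂ (fun z : Cn 2 => z j) z :=
  (EuclideanSpace.proj j : Cn 2 →L[ℂ] ℂ).differentiableAt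

lemma den_diff (z : Cn 2) : DifferentiableAt ℂ (fun z : Cn 2 => 4 - z 1 ^ 2) z :=
  ((diff_coord 1 z).fun_pow 2).const_sub 4

lemma quot_diff {N : Cn 2 → ℂ} {z : Cn 2} (hN : DifferentiableAt ℂ N z) (hz : 4 - z 1 ^ 2 ≠ 0) :
    DifferentiableAt ℂ (fun z : Cn 2 => N z / (4 - z 1 ^ 2)) z := by
  simp only [div_eq_mul_inv]
  exact hN.fun_mul ((differentiableAt_inv hz).comp z (den_diff z))

lemma Ff_diff : ∀ᶠ z in 𝓝 (0 : Cn 2), DifferentiableAt ℂ Ff z := by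
  filter_upwards [den_ne] with z hz
  have h0 := diff_coord 0 z
  have h1 := diff_coord 1 z
  exact quot_diff ((h0.const_mul 2).fun_mul ((h1.const_mul I).const_add 2)) hz

lemma Gf_diff : ∀ᶠ z in 𝓝 (0 : Cn 2), DifferentiableAt ℂ Gf z := by
  filter_upwards [den_ne] with z hz
  have h0 := diff_coord 0 z
  have h1 := diff_coord 1 z
  exact quot_diff ((h0.fun_pow 2).const_mul 4) hz

lemma hf_diff : ∀ᶠ z in 𝓝 (0 : Cn 2), DifferentiableAt ℂ hf z := by
  filter_upwards [den_ne] with z hz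
  have h1 := diff_coord 1 z
  exact quot_diff (h1.const_mul 4) hz

lemma Ff_z {z : Cn 2} (h : DifferentiableAt ℂ Ff z) (c : ℂ) :
    fderiv ℂ (fun z => c + Ff z) z (cbasis 0 1) = 2 * (2 + I * z 1) / (4 - z 1 ^ 2) := by
  apply fderiv_dir (h.const_add c)
  have : HasDerivAt (fun t : ℂ => (c + Ff z) + t * (2 * (2 + I * z 1) / (4 - z 1 ^ 2)))
      (2 * (2 + I * z 1) / (4 - z 1 ^ 2)) 0 := by
    simpa using ((hasDerivAt_id (0:ℂ)).mul_const (2 * (2 + I * z 1) / (4 - z 1 ^ 2))).const_add (c + Ff z)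
  refine this.congr_of_eventuallyEq (Filter.Eventually.of_forall fun t => ?_)
  simp [Ff, cbasis]; ring

lemma Gf_z {z : Cn 2} (h : DifferentiableAt ℂ Gf z) (c : ℂ) :
    fderiv ℂ (fun z => c + Gf z) z (cbasis 0 1) = 8 * z 0 / (4 - z 1 ^ 2) := by
  apply fderiv_dir (h.const_add c)
  have hq : HasDerivAt (fun t : ℂ => 8 * z 0 / (4 - z 1 ^ 2) + t * (4 / (4 - z 1 ^ 2))) _ 0 := 
    (DifferentiableAt.hasDerivAt (by fun_prop))
  have := ((hasDerivAt_id (0:ℂ)).mul hq).const_add (c + Gf z)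
  convert! this using 1
  · ext t
    simp [Gf, cbasis]; ring
  · simp

lemma Ff_zz (c : ℂ) : fderiv ℂ (fun z => fderiv ℂ (fun z => c + Ff z) z (cbasis 0 1)) 0 (cbasis 0 1) = 0 := by
  have e : (fun z => fderiv ℂ (fun z => c + Ff z) z (cbasis 0 1)) =ᶠ[𝓝 0]
      fun z => 2 * (2 + I * z 1) / (4 - z 1 ^ 2) := by
    filter_upwards [Ff_diff] with z hz
    exact Ff_z hz c
  rw [e.fderiv_eq]
  have h1 := diff_coord 1 0
  apply fderiv_dir (quot_diff (((h1.const_mul I).const_add 2).const_mul 2) (by simp))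
  have := hasDerivAt_const (0:ℂ) (1:ℂ)
  refine this.congr_of_eventuallyEq (Filter.Eventually.of_forall fun t => ?_)
  simp [cbasis]; norm_num

lemma Gf_zz (c : ℂ) : fderiv ℂ (fun z => fderiv ℂ (fun z => c + Gf z) z (cbasis 0 1)) 0 (cbasis 0 1) = 2 := by
  have e : (fun z => fderiv ℂ (fun z => c + Gf z) z (cbasis 0 1)) =ᶠ[𝓝 0]
      fun z => 8 * z 0 / (4 - z 1 ^ 2) := by
    filter_upwards [Gf_diff] with z hz
    exact Gf_z hz c
  rw [e.fderiv_eq]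
  have h1 := diff_coord 1 0
  apply fderiv_dir (quot_diff ((diff_coord 0 0).const_mul 8) (by simp))
  have : HasDerivAt (fun t : ℂ => t * 2) 2 0 := by simpa using (hasDerivAt_id (0:ℂ)).mul_const 2
  refine this.congr_of_eventuallyEq (Filter.Eventually.of_forall fun t => ?_)
  simp [cbasis]; ring

lemma branch {K : Cn 2 → ℂ} (hK : ∀ᶠ z in 𝓝 (0 : Cn 2), DifferentiableAt ℂ K z) (hK0 : K 0 = 0) {a : ℂ}
    (ha : a ≠ 0) : ∃ f : Cn 2 → ℂ, (∀ᶠ z in 𝓝 (0 : Cn 2), DifferentiableAt ℂ f z) ∧ f 0 = a ∧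
      ∀ z, f z ^ 2 = a ^ 2 + K z := by
  refine ⟨fun z => a * (1 + K z / a ^ 2) ^ ((2:ℕ) : ℂ)⁻¹, ?_, by simp [hK0], ?_⟩
  · have hc : ContinuousAt (fun z => 1 + K z / a ^ 2) 0 := 
      (hK.self_of_nhds.continuousAt.div_const _).const_add 1
    have hs := hc.eventually (Complex.isOpen_slitPlane.mem_nhds (by simp [hK0] : 1 + K 0 / a ^ 2 ∈ Complex.slitPlane))
    filter_upwards [hK, hs] with z h1 h2
    exact (((h1.mul_const ((a^2)⁻¹)).const_add 1).cpow_const h2).const_mul a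
  · intro z
    rw [mul_pow, Complex.cpow_nat_inv_pow _ (by norm_num)]
    field_simp

lemma exists_map {u : Cn 3} (hu : u ∈ Mq') (ha : u 0 ≠ 0) (hb : u 1 ≠ 0) {ℓ : ℕ} (hℓ : 2 ≤ ℓ) :
    u ∈ MappingLocus Mq (0 : Cn 2) Mq' ℓ := by
  obtain ⟨f, hfd, hf0, hf2⟩ := branch Ff_diff (by simp [Ff]) ha
  obtain ⟨g, hgd, hg0, hg2⟩ := branch Gf_diff (by simp [Gf]) hb
  set H : Cn 2 → Cn 3 := fun z => !₂[f z, g z, 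
    hf z + 2 * I * (starRingEnd ℂ (u 0 ^ 2) * Ff z + starRingEnd ℂ (u 1 ^ 2) * Gf z) + u 2] with hH
  have hH0 : H 0 = u := by
    ext i
    fin_cases i <;> simp [hH, hf0, hg0, hf, Ff, Gf]
  have hHd : ∀ᶠ z in 𝓝 (0 : Cn 2), DifferentiableAt ℂ H z ∧ 4 - z 1 ^ 2 ≠ 0 := by
    filter_upwards [hfd, hgd, hf_diff, Ff_diff, Gf_diff, den_ne] with z h1 h2 h3 h4 h5 h6
    refine ⟨differentiableAt_euclidean.mpr fun i => ?_, h6⟩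
    fin_cases i
    · exact h1
    · exact h2
    · exact (h3.add (((h4.const_mul _).add (h5.const_mul _)).const_mul _)).add_const _
  obtain ⟨Ω, hΩ, hΩo, h0Ω⟩ := eventually_nhds_iff.mp hHd
  refine ⟨hu, Ω, H, hΩo, h0Ω, fun z hz => (hΩ z hz).1.differentiableWithinAt, hH0, ?_, ?_⟩
  · rintro z ⟨hz, hzΩ⟩
    have h1 := sphere_map hz (hΩ z hzΩ).2
    have hu' : (u 2).im = (normSq (u 0)) ^ 2 + (normSq (u 1)) ^ 2 := hu
    show (hf z + 2 * I * (starRingEnd ℂ (u 0 ^ 2) * Ff z + starRingEnd ℂ (u 1 ^ 2) * Gf z) + u 2).im 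
      = normSq (f z) ^ 2 + normSq (g z) ^ 2
    rw [← map_pow, ← map_pow, hf2, hg2, add_im, add_im, h1, hu', ← map_pow, ← map_pow]
    generalize u 0 ^ 2 = A
    generalize u 1 ^ 2 = B
    simp [normSq_apply]
    ring
  · have e0 : (fun z => wirtD rho1 (H z) 0) = fun z => (-2 * f z) * starRingEnd ℂ (u 0 ^ 2 + Ff z) := by
      ext z
      rw [(rho1_wirtD (H z)).1, ← hf2]
      simp [hH]
    have e1 : (fun z => wirtD rho1 (H z) 1) = fun z => (-2 * g z) * starRingEnd ℂ (u 1 ^ 2 + Gf z) := by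
      ext z
      rw [(rho1_wirtD (H z)).2.1, ← hg2]
      simp [hH]
    have e2 : (fun z => wirtD rho1 (H z) 2) = fun z => -I/2 := by
      ext z
      rw [(rho1_wirtD (H z)).2.2]
    have han : AnalyticOnNhd ℝ rho1 Set.univ := by
      rw [← contDiff_omega_iff_analyticOnNhd]; exact rho1_contDiff _
    have hvan : ∀ w ∈ Mq' ∩ Set.univ, rho1 w = 0 := by
      rintro w ⟨hw, -⟩
      have hw' : (w 2).im = (normSq (w 0)) ^ 2 + (normSq (w 1)) ^ 2 := hw
      simp [rho1, hw']
    have hmF : ∀ᶠ z in 𝓝 (0 : Cn 2), DifferentiableAt ℂ (fun z => -2 * f z) z := 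
      hfd.mono fun z h => h.const_mul _
    have hmG : ∀ᶠ z in 𝓝 (0 : Cn 2), DifferentiableAt ℂ (fun z => -2 * g z) z := 
      hgd.mono fun z h => h.const_mul _
    have hKF : ∀ᶠ z in 𝓝 (0 : Cn 2), DifferentiableAt ℂ (fun z => u 0 ^ 2 + Ff z) z := 
      Ff_diff.mono fun z h => h.const_add _
    have hKG : ∀ᶠ z in 𝓝 (0 : Cn 2), DifferentiableAt ℂ (fun z => u 1 ^ 2 + Gf z) z := 
      Gf_diff.mono fun z h => h.const_add _
    rw [FinNondeg, eq_top_iff]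
    rintro w -
    set v0 : Fin 3 → ℂ := fun j => CRApplyList ([] : List (CRVectorField Mq 0)) (fun z => wirtD rho1 (H z) j) 0 with hv0
    set v1 : Fin 3 → ℂ := fun j => CRApplyList [L0] (fun z => wirtD rho1 (H z) j) 0 with hv1
    set v2 : Fin 3 → ℂ := fun j => CRApplyList [L0, L0] (fun z => wirtD rho1 (H z) j) 0 with hv2
    have v02 : v0 2 = -I/2 := congrFun e2 0
    have v10 : v1 0 = -2 * u 0 := by
      show L0.apply (fun z => wirtD rho1 (H z) 0) 0 = _
      rw [e0, L0_one hmF.self_of_nhds hKF.self_of_nhds, Ff_z Ff_diff.self_of_nhds]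
      simp [hf0, Complex.conj_ofNat]; norm_num
    have v11 : v1 1 = 0 := by
      show L0.apply (fun z => wirtD rho1 (H z) 1) 0 = _
      rw [e1, L0_one hmG.self_of_nhds hKG.self_of_nhds, Gf_z Gf_diff.self_of_nhds]
      simp
    have v12 : v1 2 = 0 := by
      show L0.apply (fun z => wirtD rho1 (H z) 2) 0 = _
      rw [e2, L0_const]
    have v20 : v2 0 = 0 := by
      show L0.apply (L0.apply (fun z => wirtD rho1 (H z) 0)) 0 = _
      rw [e0, L0_two hmF hKF, Ff_zz]
      simp
    have v21 : v2 1 = -4 * u 1 := by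
      show L0.apply (L0.apply (fun z => wirtD rho1 (H z) 1)) 0 = _
      rw [e1, L0_two hmG hKG, Gf_zz]
      simp [hg0, Complex.conj_ofNat]; ring
    have v22 : v2 2 = 0 := by
      show L0.apply (L0.apply (fun z => wirtD rho1 (H z) 2)) 0 = _
      rw [e2, L0_const, L0_const]
    have hw : w = (2 * I * w 2) • v0 + ((w 0 - 2 * I * w 2 * v0 0) / (-2 * u 0)) • v1 
        + ((w 1 - 2 * I * w 2 * v0 1) / (-4 * u 1)) • v2 := by
      ext i
      fin_cases i
      · simp [v10, v20]; field_simp; ring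
      · simp [v11, v21]; field_simp; ring
      · simp [v02, v12, v22]; linear_combination (w 2) * Complex.I_mul_I
    rw [hw]
    refine Submodule.add_mem _ (Submodule.add_mem _ ?_ ?_) ?_ <;> 
      refine Submodule.smul_mem _ _ (Submodule.subset_span ?_)
    · exact ⟨[], rho1, Set.univ, by simp, isOpen_univ, trivial, han, hvan, rfl⟩
    · exact ⟨[L0], rho1, Set.univ, by simp; omega, isOpen_univ, trivial, han, hvan, rfl⟩
    · exact ⟨[L0, L0], rho1, Set.univ, by simpa using hℓ, isOpen_univ, trivial, han, hvan, rfl⟩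

/-- **Example 6.1.** For `M = {Im w = |z|²} ⊆ ℂ²` and `M' = {Im w = |z₁|⁴ + |z₂|⁴} ⊆ ℂ³`,
the mapping locus is `E_ℓ = M' ∖ ({z₁ = 0} ∪ {z₂ = 0})` for every `ℓ ≥ 2`; moreover no
finitely nondegenerate map (of any order) sends `0` to a point with `z₁ = 0` or `z₂ = 0`. -/
theorem mapping_locus_complement_of_analytic_set :
    (∀ ℓ : ℕ, 2 ≤ ℓ →
      MappingLocus Mq (0 : Cn 2) Mq' ℓ = {u | u ∈ Mq' ∧ u 0 ≠ 0 ∧ u 1 ≠ 0}) ∧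
    (∀ ℓ : ℕ, ∀ u ∈ MappingLocus Mq (0 : Cn 2) Mq' ℓ, u 0 ≠ 0 ∧ u 1 ≠ 0) := by
  have hne : ∀ ℓ : ℕ, ∀ u ∈ MappingLocus Mq (0 : Cn 2) Mq' ℓ, u 0 ≠ 0 ∧ u 1 ≠ 0 := by
    rintro ℓ u ⟨hu, Ω, H, hΩ, h0, hH, rfl, hM, hnd⟩
    exact ⟨degenerate hΩ h0 hH hM hnd 0 (by decide), degenerate hΩ h0 hH hM hnd 1 (by decide)⟩
  refine ⟨fun ℓ hℓ => Set.Subset.antisymm (fun u hu => ⟨hu.1, hne ℓ u hu⟩) ?_, hne⟩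
  rintro u ⟨hu, ha, hb⟩
  exact exists_map hu ha hb hℓ

end
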